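/- arXiv:2410.13251 — 4 statements merged into one kernel-verified Lean document; each statement's English description precedes it below -/
import Mathlib

section
/- The networked system (𝒞, 𝒜) is observable if and only if the pair (C_i, A_i) is observable for every i = 1, …, N. -/
open Matrix BigOperators

/-- Complexification of a real matrix (entrywise coercion `ℝ → ℂ`). -/
noncomputable def matC {m n : Type*} (M : Matrix m n ℝ) : Matrix m n ℂ :=
  M.map (fun x => (x : ℂ))

/-- PBH eigenvector test for controllability of the pair `(A, B)`:
for every `λ ∈ ℂ`, the only row vector `v` with `v A = λ v` and `v B = 0` is `v = 0`. -/
def IsControllablePair {n p : Type*} [Fintype n] [Fintype p]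
    (A : Matrix n n ℝ) (B : Matrix n p ℝ) : Prop :=
  ∀ (lam : ℂ) (v : n → ℂ), v ᵥ* matC A = lam • v → v ᵥ* matC B = 0 → v = 0

/-- PBH eigenvector test for observability of the pair `(C, A)`:
for every `λ ∈ ℂ`, the only column vector `v` with `A v = λ v` and `C v = 0` is `v = 0`. -/
def IsObservablePair {m n : Type*} [Fintype m] [Fintype n]
    (C : Matrix m n ℝ) (A : Matrix n n ℝ) : Prop :=
  ∀ (lam : ℂ) (v : n → ℂ), matC A *ᵥ v = lam • v → matC C *ᵥ v = 0 → v = 0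

/-- The set of complex eigenvalues of a real square matrix. -/
noncomputable def eigSet {n : Type*} [Fintype n] (M : Matrix n n ℝ) : Set ℂ :=
  {μ | ∃ v : n → ℂ, v ≠ 0 ∧ matC M *ᵥ v = μ • v}

/-- `v` is a left eigenvector of the real matrix `M` for the eigenvalue `μ`. -/
def IsLeftEig {n : Type*} [Fintype n] (M : Matrix n n ℝ) (μ : ℂ) (v : n → ℂ) : Prop :=
  v ≠ 0 ∧ v ᵥ* matC M = μ • v

/-- The networked state matrix `𝒜`: the block matrix whose `(i,j)` block is
`A i + β i i • (H i * C i)` when `j = i` and `β i j • (H i * C j)` when `j ≠ i`. -/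
noncomputable def netA (N : ℕ) (n : Fin N → ℕ) (m : ℕ)
    (A : ∀ i, Matrix (Fin (n i)) (Fin (n i)) ℝ)
    (H : ∀ i, Matrix (Fin (n i)) (Fin m) ℝ)
    (C : ∀ i, Matrix (Fin m) (Fin (n i)) ℝ)
    (β : Fin N → Fin N → ℝ) :
    Matrix (Σ i, Fin (n i)) (Σ i, Fin (n i)) ℝ :=
  Matrix.blockDiagonal' A +
    Matrix.of (fun x y => β x.1 y.1 * (H x.1 * C y.1) x.2 y.2)

/-- The networked input matrix `ℬ = blockdiag(δ₁B₁, …, δ_N B_N)`. -/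
noncomputable def netB (N : ℕ) (n p : Fin N → ℕ)
    (B : ∀ i, Matrix (Fin (n i)) (Fin (p i)) ℝ) (δ : Fin N → ℝ) :
    Matrix (Σ i, Fin (n i)) (Σ i, Fin (p i)) ℝ :=
  Matrix.blockDiagonal' (fun i => δ i • B i)

/-- The networked output matrix `𝒞 = blockdiag(C₁, …, C_N)`. -/
noncomputable def netC (N : ℕ) (n : Fin N → ℕ) (m : ℕ)
    (C : ∀ i, Matrix (Fin m) (Fin (n i)) ℝ) :
    Matrix (Σ _ : Fin N, Fin m) (Σ i, Fin (n i)) ℝ :=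
  Matrix.blockDiagonal' C

/-- The row vector `[0, …, 0, ζ, 0, …, 0]` with block `ζ` in position `i`. -/
def padded {N : ℕ} (n : Fin N → ℕ) (i : Fin N) (ζ : Fin (n i) → ℂ) :
    (Σ j, Fin (n j)) → ℂ :=
  fun x => if h : x.1 = i then ζ (Fin.cast (congrArg n h) x.2) else 0

theorem matC_add {m n : Type*} (M M' : Matrix m n ℝ) : matC (M + M') = matC M + matC M' := by
  ext
  simp [matC]

theorem matC_mul {l m n : Type*} [Fintype m] (M : Matrix l m ℝ) (M' : Matrix m n ℝ) :
    matC (M * M') = matC M * matC M' :=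
  Matrix.map_mul (f := Complex.ofRealHom)

theorem matC_blockDiagonal'_mulVec_apply {ι : Type*} {m n : ι → Type*} [Fintype ι]
    [DecidableEq ι] [∀ i, Fintype (n i)] (M : ∀ i, Matrix (m i) (n i) ℝ)
    (v : (Σ i, n i) → ℂ) (i : ι) (k : m i) :
    (matC (blockDiagonal' M) *ᵥ v) ⟨i, k⟩ = (matC (M i) *ᵥ fun l => v ⟨i, l⟩) k := by
  simp only [mulVec, dotProduct, Fintype.sum_sigma]
  rw [Finset.sum_eq_single i]
  · simp [matC]
  · intro j _ hj
    simp [matC, blockDiagonal'_apply_ne _ _ _ hj.symm]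
  · simp

/-- Output injection preserves observability. -/
theorem isObservablePair_add_mul_iff {m n : Type*} [Fintype m] [Fintype n]
    (C : Matrix m n ℝ) (A : Matrix n n ℝ) (G : Matrix n m ℝ) :
    IsObservablePair C (A + G * C) ↔ IsObservablePair C A := by
  have key (v : n → ℂ) (hv : matC C *ᵥ v = 0) : matC (A + G * C) *ᵥ v = matC A *ᵥ v := by
    rw [matC_add, matC_mul, add_mulVec, ← mulVec_mulVec, hv, mulVec_zero, add_zero]
  constructor
  · intro h lam v hA hC
    exact h lam v ((key v hC).trans hA) hC
  · intro h lam v hA hC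
    exact h lam v ((key v hC).symm.trans hA) hC

/-- A block diagonal pair is observable iff each of its blocks is. -/
theorem isObservablePair_blockDiagonal'_iff {ι : Type*} {m n : ι → Type*} [Fintype ι]
    [DecidableEq ι] [∀ i, Fintype (m i)] [∀ i, Fintype (n i)]
    (C : ∀ i, Matrix (m i) (n i) ℝ) (A : ∀ i, Matrix (n i) (n i) ℝ) :
    IsObservablePair (blockDiagonal' C) (blockDiagonal' A) ↔
      ∀ i, IsObservablePair (C i) (A i) := by
  constructor
  · intro h i lam v hA hC
    let w : ∀ j, n j → ℂ := Pi.single i v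
    have hw : (fun x : Σ j, n j => w x.1 x.2) = 0 := by
      refine h lam _ ?_ ?_
      · ext ⟨j, k⟩
        rw [matC_blockDiagonal'_mulVec_apply]
        change (matC (A j) *ᵥ w j) k = lam * w j k
        obtain rfl | hj := eq_or_ne j i
        · simpa [w] using congrFun hA k
        · simp [w, hj]
      · ext ⟨j, k⟩
        rw [matC_blockDiagonal'_mulVec_apply]
        change (matC (C j) *ᵥ w j) k = 0
        obtain rfl | hj := eq_or_ne j i
        · simpa [w] using congrFun hC k
        · simp [w, hj]
    ext k
    simpa [w] using congrFun hw ⟨i, k⟩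
  · intro h lam v hA hC
    ext ⟨i, k⟩
    refine congrFun (h i lam (fun l => v ⟨i, l⟩) ?_ ?_) k
    · ext l
      rw [← matC_blockDiagonal'_mulVec_apply, hA]
      rfl
    · ext l
      rw [← matC_blockDiagonal'_mulVec_apply, hC]
      rfl

/-- The networked state matrix arises from the decoupled one by output injection. -/
theorem netA_eq_blockDiagonal'_add_mul_netC (N : ℕ) (n : Fin N → ℕ) (m : ℕ)
    (A : ∀ i, Matrix (Fin (n i)) (Fin (n i)) ℝ)
    (H : ∀ i, Matrix (Fin (n i)) (Fin m) ℝ)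
    (C : ∀ i, Matrix (Fin m) (Fin (n i)) ℝ)
    (β : Fin N → Fin N → ℝ) :
    netA N n m A H C β = blockDiagonal' A +
      Matrix.of (fun (x : Σ i, Fin (n i)) (y : Σ _ : Fin N, Fin m) =>
        β x.1 y.1 * H x.1 x.2 y.2) * netC N n m C := by
  rw [netA]
  congr 1
  ext ⟨i, k⟩ ⟨j, l⟩
  simp only [netC, of_apply, mul_apply, Fintype.sum_sigma]
  rw [Finset.sum_eq_single j]
  · simp [Finset.mul_sum, mul_assoc]
  · intro b _ hb
    simp [blockDiagonal'_apply_ne _ _ _ hb]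
  · simp

theorem networked_observability_iff_node_observability
    (N : ℕ) (n : Fin N → ℕ) (m : ℕ)
    (A : ∀ i, Matrix (Fin (n i)) (Fin (n i)) ℝ)
    (C : ∀ i, Matrix (Fin m) (Fin (n i)) ℝ)
    (H : ∀ i, Matrix (Fin (n i)) (Fin m) ℝ)
    (β : Fin N → Fin N → ℝ) :
    IsObservablePair (netC N n m C) (netA N n m A H C β) ↔
      ∀ i, IsObservablePair (C i) (A i) := by
  rw [netA_eq_blockDiagonal'_add_mul_netC, isObservablePair_add_mul_iff]
  exact isObservablePair_blockDiagonal'_iff C A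
end

section
/- Suppose node i of the networked system has no external control input, i.e. δ_i = 0. If the networked system (𝒜, ℬ) is controllable, then the pair (A_i, H_i) is controllable. -/
open Matrix BigOperators

theorem padded_vecMul {N : ℕ} {n : Fin N → ℕ} {κ : Type*} (i : Fin N) (ζ : Fin (n i) → ℂ)
    (M : Matrix (Σ j, Fin (n j)) κ ℂ) (y : κ) :
    (padded n i ζ ᵥ* M) y = ∑ k, ζ k * M ⟨i, k⟩ y := by
  simp only [vecMul, dotProduct, Fintype.sum_sigma]
  rw [Finset.sum_eq_single i]
  · simp [padded]
  · intro j _ hj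
    simp [padded, hj]
  · simp

theorem padded_vecMul_netA {N : ℕ} {n : Fin N → ℕ} {m : ℕ}
    (A : ∀ i, Matrix (Fin (n i)) (Fin (n i)) ℝ)
    (H : ∀ i, Matrix (Fin (n i)) (Fin m) ℝ)
    (C : ∀ i, Matrix (Fin m) (Fin (n i)) ℝ)
    (β : Fin N → Fin N → ℝ) (i : Fin N) {lam : ℂ} {ζ : Fin (n i) → ℂ}
    (hA : ζ ᵥ* matC (A i) = lam • ζ) (hH : ζ ᵥ* matC (H i) = 0) :
    padded n i ζ ᵥ* matC (netA N n m A H C β) = lam • padded n i ζ := by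
  have hHC (j : Fin N) (l : Fin (n j)) :
      ∑ k, ζ k * ((β i j * (H i * C j) k l : ℝ) : ℂ) = 0 := by
    have h : matC (H i * C j) = matC (H i) * matC (C j) :=
      Matrix.map_mul (f := Complex.ofRealHom)
    have h0 : (ζ ᵥ* matC (H i * C j)) l = 0 := by
      rw [h, ← vecMul_vecMul, hH, zero_vecMul, Pi.zero_apply]
    calc ∑ k, ζ k * ((β i j * (H i * C j) k l : ℝ) : ℂ)
        = β i j * (ζ ᵥ* matC (H i * C j)) l := by
          simp only [vecMul, dotProduct, Finset.mul_sum, matC, map_apply, Complex.ofReal_mul]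
          exact Finset.sum_congr rfl fun _ _ => by ring
      _ = 0 := by rw [h0, mul_zero]
  ext ⟨j, l⟩
  rw [padded_vecMul]
  simp only [matC, netA, map_apply, Matrix.add_apply, of_apply, Complex.ofReal_add, mul_add,
    Finset.sum_add_distrib, hHC, add_zero]
  by_cases hj : j = i
  · subst hj
    simpa [padded, vecMul, dotProduct, matC] using congrFun hA l
  · simp [padded, hj, blockDiagonal'_apply_ne A _ _ (Ne.symm hj)]

theorem padded_vecMul_netB {N : ℕ} {n p : Fin N → ℕ}
    (B : ∀ i, Matrix (Fin (n i)) (Fin (p i)) ℝ) (δ : Fin N → ℝ)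
    (i : Fin N) (hδ : δ i = 0) (ζ : Fin (n i) → ℂ) :
    padded n i ζ ᵥ* matC (netB N n p B δ) = 0 := by
  ext ⟨j, l⟩
  rw [padded_vecMul]
  by_cases hj : i = j
  · subst hj
    simp [matC, netB, hδ]
  · simp [matC, netB, blockDiagonal'_apply_ne _ _ _ hj]

theorem networked_no_external_input_necessary_condition
    (N : ℕ) (n p : Fin N → ℕ) (m : ℕ)
    (A : ∀ i, Matrix (Fin (n i)) (Fin (n i)) ℝ)
    (B : ∀ i, Matrix (Fin (n i)) (Fin (p i)) ℝ)
    (C : ∀ i, Matrix (Fin m) (Fin (n i)) ℝ)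
    (H : ∀ i, Matrix (Fin (n i)) (Fin m) ℝ)
    (β : Fin N → Fin N → ℝ) (δ : Fin N → ℝ)
    (hδ : ∀ i, δ i = 0 ∨ δ i = 1)
    (i : Fin N) (hnoext : δ i = 0)
    (hctrl : IsControllablePair (netA N n m A H C β) (netB N n p B δ)) :
    IsControllablePair (A i) (H i) := by
  intro lam ζ hA hH
  have h := hctrl lam (padded n i ζ) (padded_vecMul_netA A H C β i hA hH)
    (padded_vecMul_netB B δ i hnoext ζ)
  ext k
  simpa [padded] using congrFun h ⟨i, k⟩
end

section
/- In the homogeneous networked system with 𝒜 = I_N ⊗ A + L ⊗ (HC) and ℬ = Δ ⊗ B, suppose node i has no external control input, i.e. δ_i = 0. If (𝒜, ℬ) is controllable, then (A, HC) is a controllable pair. -/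
open Matrix BigOperators

open scoped Kronecker in
/-- A row vector supported in block `i`, multiplied by a Kronecker product. -/
theorem single_vecMul_matC_kronecker {ι κ μ ν : Type*} [Fintype ι] [DecidableEq ι] [Fintype μ]
    (i : ι) (v : μ → ℂ) (X : Matrix ι κ ℝ) (Y : Matrix μ ν ℝ) (k : κ) (b : ν) :
    ((fun x : ι × μ => if x.1 = i then v x.2 else 0) ᵥ* matC (X ⊗ₖ Y)) (k, b) =
      (X i k : ℂ) * (v ᵥ* matC Y) b := by
  simp only [vecMul, dotProduct, matC, map_apply, kroneckerMap_apply, Fintype.sum_prod_type,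
    ite_mul, zero_mul, Complex.ofReal_mul]
  rw [Finset.sum_eq_single i (fun j _ hj => by simp [hj]) (by simp), Finset.mul_sum]
  exact Finset.sum_congr rfl fun a _ => by simp only [if_true]; ring

open scoped Kronecker in
theorem homogeneous_no_external_input_necessary_condition
    (N n p m : ℕ)
    (A : Matrix (Fin n) (Fin n) ℝ) (B : Matrix (Fin n) (Fin p) ℝ)
    (C : Matrix (Fin m) (Fin n) ℝ) (H : Matrix (Fin n) (Fin m) ℝ)
    (L : Matrix (Fin N) (Fin N) ℝ) (δ : Fin N → ℝ)
    (hδ : ∀ i, δ i = 0 ∨ δ i = 1)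
    (i : Fin N) (hnoext : δ i = 0)
    (hctrl : IsControllablePair
      ((1 : Matrix (Fin N) (Fin N) ℝ) ⊗ₖ A + L ⊗ₖ (H * C))
      ((Matrix.diagonal δ) ⊗ₖ B)) :
    IsControllablePair A (H * C) := by
  intro lam v hA hHC
  set w : Fin N × Fin n → ℂ := fun x => if x.1 = i then v x.2 else 0 with hw
  have h_zero : w = 0 := by
    refine hctrl lam w ?_ ?_
    · have h_add : matC ((1 : Matrix (Fin N) (Fin N) ℝ) ⊗ₖ A + L ⊗ₖ (H * C)) =
          matC ((1 : Matrix (Fin N) (Fin N) ℝ) ⊗ₖ A) + matC (L ⊗ₖ (H * C)) := by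
        ext; simp [matC]
      ext ⟨k, b⟩
      rw [h_add, vecMul_add, Pi.add_apply, hw, single_vecMul_matC_kronecker,
        single_vecMul_matC_kronecker, hA, hHC]
      by_cases hk : k = i
      · subst hk
        simp
      · simp [hk, one_apply_ne (Ne.symm hk)]
    · ext ⟨k, b⟩
      rw [hw, single_vecMul_matC_kronecker]
      simp [diagonal_apply, hnoext]
  ext a
  simpa [hw] using congrFun h_zero (i, a)
end

section
/- In the homogeneous networked system with 𝒜 = I_N ⊗ A + L ⊗ (HC) and ℬ = Δ ⊗ B, suppose the number of nodes with external control inputs is m (i.e. |{i : δ_i ≠ 0}| = m) and N > m · rank(B). If (𝒜, ℬ) is controllable, then (C, A) is an observable pair. -/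
open Matrix BigOperators

open Module in
theorem Matrix.exists_mul_eq_of_rank {K : Type*} [Field K] {m n : Type*} [Fintype m] [Fintype n]
    (B : Matrix m n K) :
    ∃ (U : Matrix m (Fin B.rank) K) (W : Matrix (Fin B.rank) n K), B = U * W := by
  classical
  let b : Basis (Fin B.rank) K (LinearMap.range B.mulVecLin) := finBasis K _
  have hcol (j : n) : B.col j ∈ LinearMap.range B.mulVecLin :=
    ⟨Pi.single j 1, by simp⟩
  refine ⟨of fun i k => (b k : m → K) i, of fun k j => b.repr ⟨B.col j, hcol j⟩ k, ?_⟩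
  ext i j
  have h := congrArg (fun y : LinearMap.range B.mulVecLin => (y : m → K) i)
    (b.sum_repr ⟨B.col j, hcol j⟩)
  simp only [Submodule.coe_sum, Submodule.coe_smul, Finset.sum_apply, Pi.smul_apply,
    smul_eq_mul, col_apply] at h
  simp [mul_apply, ← h, mul_comm]

open Module in
theorem Matrix.finrank_ker_mulVecLin_transpose {K : Type*} [Field K] {n : Type*} [Fintype n]
    (M : Matrix n n K) :
    finrank K (LinearMap.ker Mᵀ.mulVecLin) = finrank K (LinearMap.ker M.mulVecLin) := by
  have h₁ := M.mulVecLin.finrank_range_add_finrank_ker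
  have h₂ := Mᵀ.mulVecLin.finrank_range_add_finrank_ker
  have h₃ := M.rank_transpose
  simp only [rank] at h₃
  omega

open Module in
/-- If the eigenvalue `μ` of `M` has geometric multiplicity exceeding the dimension of `V`, every
linear map into `V` annihilates some left eigenvector of `M` for `μ`. -/
theorem Matrix.exists_left_eigenvector_map_eq_zero {K : Type*} [Field K] {n : Type*} [Fintype n]
    [DecidableEq n] {V : Type*} [AddCommGroup V] [Module K V] [FiniteDimensional K V]
    (M : Matrix n n K) (μ : K) {ι : Type*} [Fintype ι] (f : (ι → K) →ₗ[K] (n → K))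
    (hf : Function.Injective f) (hM : ∀ c, M *ᵥ f c = μ • f c)
    (g : (n → K) →ₗ[K] V) (hV : finrank K V < Fintype.card ι) :
    ∃ v : n → K, v ≠ 0 ∧ v ᵥ* M = μ • v ∧ g v = 0 := by
  let T := M - μ • (1 : Matrix n n K)
  have hT : ∀ c, f c ∈ LinearMap.ker T.mulVecLin := fun c => by
    simp [T, hM]
  have hcard : Fintype.card ι ≤ finrank K (LinearMap.ker T.mulVecLin) := by
    rw [← finrank_fintype_fun_eq_card K (η := ι)]
    exact LinearMap.finrank_le_finrank_of_injective (f := f.codRestrict _ hT)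
      fun a b hab => hf (congrArg Subtype.val hab)
  rw [← finrank_ker_mulVecLin_transpose] at hcard
  have hker : LinearMap.ker (g.domRestrict (LinearMap.ker Tᵀ.mulVecLin)) ≠ ⊥ :=
    LinearMap.ker_ne_bot_of_finrank_lt (hV.trans_le hcard)
  obtain ⟨v, hv, hv0⟩ := Submodule.exists_mem_ne_zero_of_ne_bot hker
  refine ⟨v, by simpa using hv0, ?_, hv⟩
  have h := v.2
  rw [LinearMap.mem_ker, mulVecLin_apply, mulVec_transpose, vecMul_sub, vecMul_smul, vecMul_one,
    sub_eq_zero] at h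
  exact h

open scoped Kronecker Classical in
theorem homogeneous_controllability_needs_observability
    (N n p m : ℕ)
    (A : Matrix (Fin n) (Fin n) ℝ) (B : Matrix (Fin n) (Fin p) ℝ)
    (C : Matrix (Fin m) (Fin n) ℝ) (H : Matrix (Fin n) (Fin m) ℝ)
    (L : Matrix (Fin N) (Fin N) ℝ) (δ : Fin N → ℝ)
    (hδ : ∀ i, δ i = 0 ∨ δ i = 1)
    (hcard : N > (Finset.univ.filter (fun i : Fin N => δ i ≠ 0)).card * B.rank)
    (hctrl : IsControllablePair
      ((1 : Matrix (Fin N) (Fin N) ℝ) ⊗ₖ A + L ⊗ₖ (H * C))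
      ((Matrix.diagonal δ) ⊗ₖ B)) :
    IsObservablePair C A := by
  intro lam x hx hCx
  by_contra hx0
  obtain ⟨a₀, ha₀⟩ := Function.ne_iff.mp hx0
  obtain ⟨U, W, hUW⟩ := B.exists_mul_eq_of_rank
  let f : (Fin N → ℂ) →ₗ[ℂ] (Fin N × Fin n → ℂ) :=
    { toFun := fun c q => c q.1 * x q.2
      map_add' := fun c d => by ext; simp [add_mul]
      map_smul' := fun r c => by ext; simp [mul_assoc] }
  let g : (Fin N × Fin n → ℂ) →ₗ[ℂ] ({i : Fin N // δ i ≠ 0} × Fin B.rank → ℂ) :=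
    { toFun := fun v q => ((fun a => v (q.1.1, a)) ᵥ* matC U) q.2
      map_add' := fun v w => by
        ext; simp [vecMul, dotProduct, add_mul, Finset.sum_add_distrib]
      map_smul' := fun r v => by
        ext; simp [vecMul, dotProduct, mul_assoc, Finset.mul_sum] }
  have hf : Function.Injective f := fun c d h => by
    ext i
    exact mul_right_cancel₀ ha₀ (congrFun h (i, a₀))
  have hHC : matC (H * C) *ᵥ x = 0 := by
    have : matC (H * C) = matC H * matC C := Matrix.map_mul (f := Complex.ofRealHom)
    rw [this, ← mulVec_mulVec, hCx, mulVec_zero]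
  obtain ⟨v, hv0, hv, hgv⟩ := exists_left_eigenvector_map_eq_zero
    (matC ((1 : Matrix (Fin N) (Fin N) ℝ) ⊗ₖ A + L ⊗ₖ (H * C))) lam f hf (fun c => by
      ext ⟨i, a⟩
      have h₁ := congrFun hx a
      have h₂ := congrFun hHC a
      simp only [mulVec, dotProduct, matC, map_apply, Pi.smul_apply, smul_eq_mul,
        Pi.zero_apply] at h₁ h₂
      have h₃ (j : Fin N) : ∑ b, (((1 : Matrix (Fin N) (Fin N) ℝ) i j * A a b
          + L i j * (H * C) a b : ℝ) : ℂ) * (c j * x b)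
          = (((1 : Matrix (Fin N) (Fin N) ℝ) i j : ℝ) : ℂ) * c j * (lam * x a) := by
        rw [← h₁, ← add_zero (_ * _ * _), ← mul_zero ((L i j : ℂ) * c j), ← h₂,
          Finset.mul_sum, Finset.mul_sum, ← Finset.sum_add_distrib]
        refine Finset.sum_congr rfl fun b _ => ?_
        push_cast
        ring
      simp only [mulVec, dotProduct, matC, map_apply, Matrix.add_apply, kroneckerMap_apply,
        Pi.smul_apply, smul_eq_mul, Fintype.sum_prod_type, f, LinearMap.coe_mk, AddHom.coe_mk, h₃]
      rw [Finset.sum_eq_single i (fun j _ hj => by simp [one_apply_ne hj.symm]) (by simp)]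
      simp only [one_apply_eq]
      push_cast
      ring) g (by
      simpa [Fintype.card_subtype] using hcard)
  refine hv0 (hctrl lam v hv ?_)
  ext ⟨i, k⟩
  simp only [vecMul, dotProduct, matC, map_apply, kroneckerMap_apply, Fintype.sum_prod_type,
    Pi.zero_apply]
  rw [Finset.sum_eq_single i (fun j _ hj => by simp [diagonal_apply_ne _ hj]) (by simp)]
  by_cases hi : δ i = 0
  · simp [hi]
  have hvU : (fun a => v (i, a)) ᵥ* matC U = 0 :=
    funext fun r => congrFun hgv (⟨i, hi⟩, r)
  have hB : matC B = matC U * matC W := by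
    conv_lhs => rw [hUW]
    exact Matrix.map_mul (f := Complex.ofRealHom)
  have hvB : (fun a => v (i, a)) ᵥ* matC B = 0 := by
    rw [hB, ← vecMul_vecMul, hvU, zero_vecMul]
  have h := congrFun hvB k
  simp only [vecMul, dotProduct, matC, map_apply, Pi.zero_apply] at h
  rw [← mul_zero (δ i : ℂ), ← h, Finset.mul_sum]
  refine Finset.sum_congr rfl fun a _ => ?_
  rw [diagonal_apply_eq]
  push_cast
  ring
end
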